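/- Let f : ℝ → ℝ be a nonincreasing convex function on an interval [a,b]. Suppose the point τ* := inf{τ : f(τ) ≤ 0} lies in (a,b) and the nondegeneracy condition g* := inf{g : g ∈ ∂f(τ*)} < 0 holds. Fix two points τ₀ < τ₁ < τ* in (a,b) and consider the secant iteration: τ_{k+1} = τ_k if f(τ_k) = 0, and otherwise τ_{k+1} = τ_k − f(τ_k)·(τ_k − τ_{k-1})/(f(τ_k) − f(τ_{k-1})). If the sequence terminates finitely at some τ_k (i.e., f(τ_k) = 0) then τ_k = τ*. If it does not terminate finitely, then the iterates are strictly increasing with τ_k < τ*, for every k ≥ 1 and every γ_k ∈ ∂f(τ_{k-1}) one has |τ* − τ_{k+1}| ≤ (1 − g*/γ_k)|τ* − τ_k|, and τ_k increases to τ* q-superlinearly (i.e., |τ* − τ_{k+1}|/|τ* − τ_k| → 0). -/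

import Mathlib

open Filter Topology Set

/-- A convex nonincreasing function vanishes at an interior infimum of its `0`-sublevel set. -/
lemma ConvexOn.eq_zero_of_isGLB_sublevel {f : ℝ → ℝ} {a b r : ℝ}
    (hconv : ConvexOn ℝ (Icc a b) f) (hdec : AntitoneOn f (Icc a b)) (hr : r ∈ Ioo a b)
    (hglb : IsGLB {t | t ∈ Icc a b ∧ f t ≤ 0} r) : f r = 0 := by
  have hcont : ContinuousAt f r := by
    have h := hconv.continuousOn_interior
    rw [interior_Icc] at h
    exact h.continuousAt (Ioo_mem_nhds hr.1 hr.2)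
  apply le_antisymm
  · refine le_of_tendsto (hcont.tendsto.mono_left (nhdsWithin_le_nhds (s := Ioi r))) ?_
    filter_upwards [Ioo_mem_nhdsGT hr.2] with t ht
    obtain ⟨s, hs, -, hst⟩ := hglb.exists_between ht.1
    exact (hdec hs.1 ⟨by linarith [hr.1, ht.1], ht.2.le⟩ hst.le).trans hs.2
  · refine ge_of_tendsto (hcont.tendsto.mono_left (nhdsWithin_le_nhds (s := Iio r))) ?_
    filter_upwards [Ioo_mem_nhdsLT hr.1] with t ht
    by_contra! h
    exact absurd (hglb.1 ⟨⟨ht.1.le, by linarith [hr.2, ht.2]⟩, h.le⟩) (not_le.2 ht.2)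

/-- The subdifferential of a function relative to a set is closed. -/
lemma isClosed_setOf_subgradient (f : ℝ → ℝ) (s : Set ℝ) (x : ℝ) :
    IsClosed {g : ℝ | ∀ y ∈ s, f x + g * (y - x) ≤ f y} := by
  simp only [ofPred_forall]
  exact isClosed_biInter fun y _ => isClosed_le (by fun_prop) continuous_const

/-- Left of a zero `r`, a secant through two points where the convex function is positive at the
right one has negative slope. -/
lemma ConvexOn.secant_slope_neg {f : ℝ → ℝ} {s : Set ℝ} (hconv : ConvexOn ℝ s f) {x y r : ℝ}
    (hx : x ∈ s) (hr : r ∈ s) (hxy : x < y) (hyr : y < r) (hy : 0 < f y) (hfr : f r = 0) :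
    (f y - f x) / (y - x) < 0 := by
  refine (hconv.slope_mono_adjacent hx hr hxy hyr).trans_lt ?_
  rw [hfr]
  exact div_neg_of_neg_of_pos (by linarith) (by linarith)

/-- A secant step from the left of a zero of a convex function does not overshoot. -/
lemma ConvexOn.secant_step_le {f : ℝ → ℝ} {s : Set ℝ} (hconv : ConvexOn ℝ s f) {x y r : ℝ}
    (hx : x ∈ s) (hr : r ∈ s) (hxy : x < y) (hyr : y < r) (hy : 0 < f y) (hfr : f r = 0) :
    y - f y / ((f y - f x) / (y - x)) ≤ r := by
  have hneg := hconv.secant_slope_neg hx hr hxy hyr hy hfr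
  have hle := hconv.slope_mono_adjacent hx hr hxy hyr
  rw [hfr, le_div_iff₀ (by linarith)] at hle
  have : y - r ≤ f y / ((f y - f x) / (y - x)) := by
    rw [le_div_iff_of_neg hneg]
    linarith
  linarith

/-- Error bound for a Newton-like step with slope `m` at `y`, when `g` supports `f` at `r`. -/
lemma newton_step_error_le {v g m γ y r : ℝ} (hg : g ≤ 0) (hγm : γ ≤ m) (hm : m < 0)
    (hyr : y ≤ r) (hv : g * (y - r) ≤ v) :
    r - (y - v / m) ≤ (1 - g / γ) * (r - y) := by
  have h₁ : v / m ≤ g * (y - r) / m := div_le_div_of_nonpos_of_le hm.le hv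
  have h₂ : g * (y - r) * m⁻¹ ≤ g * (y - r) * γ⁻¹ :=
    mul_le_mul_of_nonneg_left ((inv_le_inv_of_neg hm (hγm.trans_lt hm)).2 hγm)
      (mul_nonneg_of_nonpos_of_nonpos hg (by linarith))
  rw [div_eq_mul_inv (g * (y - r))] at h₁
  calc r - (y - v / m) = (r - y) + v / m := by ring
    _ ≤ (r - y) + g * (y - r) * γ⁻¹ := by linarith
    _ = (1 - g / γ) * (r - y) := by ring

/-- Increasing secant iterates below a zero `r` of a convex function converge to `r`, and the
slopes of their secants converge to the least subgradient at `r`. -/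
lemma ConvexOn.tendsto_secant {f : ℝ → ℝ} {s : Set ℝ} (hconv : ConvexOn ℝ s f) {r g : ℝ}
    (hr : r ∈ s) (hfr : f r = 0) (hg : IsLeast {g : ℝ | ∀ y ∈ s, f r + g * (y - r) ≤ f y} g)
    (hg_neg : g < 0) {τ : ℕ → ℝ} (hmem : ∀ k, τ k ∈ s) (hτ : StrictMono τ) (hlt : ∀ k, τ k < r)
    (hpos : ∀ k, 0 < f (τ (k + 1)))
    (hstep : ∀ k, τ (k + 2) =
      τ (k + 1) - f (τ (k + 1)) / ((f (τ (k + 1)) - f (τ k)) / (τ (k + 1) - τ k))) :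
    Tendsto τ atTop (𝓝 r) ∧
      Tendsto (fun k => (f (τ (k + 1)) - f (τ k)) / (τ (k + 1) - τ k)) atTop (𝓝 g) := by
  set m : ℕ → ℝ := fun k => (f (τ (k + 1)) - f (τ k)) / (τ (k + 1) - τ k) with hm
  have hm_mono : Monotone m := monotone_nat_of_le_succ fun k =>
    hconv.slope_mono_adjacent (hmem _) (hmem _) (hτ k.lt_succ_self) (hτ (k + 1).lt_succ_self)
  have hm_neg (k) : m k < 0 :=
    hconv.secant_slope_neg (hmem _) hr (hτ k.lt_succ_self) (hlt _) (hpos k) hfr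
  have hlow (k) : g * (τ k - r) ≤ f (τ k) := by simpa [hfr] using hg.1 _ (hmem k)
  have hmr (k) : m k ≤ (f r - f (τ (k + 1))) / (r - τ (k + 1)) :=
    hconv.slope_mono_adjacent (hmem _) hr (hτ k.lt_succ_self) (hlt _)
  have hm_le (k) : m k ≤ g := by
    refine (hmr k).trans ?_
    rw [div_le_iff₀ (by linarith [hlt (k + 1)]), hfr]
    linarith [hlow (k + 1)]
  have hτ_lim : Tendsto τ atTop (𝓝 r) := by
    have hL := tendsto_atTop_ciSup hτ.monotone ⟨r, forall_mem_range.2 fun k => (hlt k).le⟩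
    set L := ⨆ k, τ k
    have hbound (k) : g * (τ (k + 1) - r) ≤ m 0 * (τ (k + 1) - τ (k + 2)) := by
      have h₁ : m k * (τ (k + 1) - τ (k + 2)) = f (τ (k + 1)) := by
        rw [hstep k]
        have := (hm_neg k).ne
        change m k * (τ (k + 1) - (τ (k + 1) - f (τ (k + 1)) / m k)) = _
        field_simp
        ring
      have h₂ : τ (k + 1) - τ (k + 2) ≤ 0 := by linarith [hτ (k + 1).lt_succ_self]
      linarith [hlow (k + 1), mul_le_mul_of_nonpos_right (hm_mono k.zero_le) h₂]
    have h₁ := (tendsto_add_atTop_iff_nat 1).2 hL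
    have h₂ := (tendsto_add_atTop_iff_nat 2).2 hL
    have h₃ := le_of_tendsto_of_tendsto' ((h₁.sub_const r).const_mul g)
      ((h₁.sub h₂).const_mul (m 0)) hbound
    have h₄ : L ≤ r := le_of_tendsto' hL fun k => (hlt k).le
    have h₅ : r ≤ L := by nlinarith
    rwa [le_antisymm h₄ h₅] at hL
  refine ⟨hτ_lim, ?_⟩
  have hS := tendsto_atTop_ciSup hm_mono ⟨g, forall_mem_range.2 hm_le⟩
  have hmS (k) : m k ≤ ⨆ k, m k := le_ciSup ⟨g, forall_mem_range.2 hm_le⟩ k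
  set S := ⨆ k, m k
  have hSg : S ≤ g := le_of_tendsto' hS hm_le
  have hfτ : Tendsto (fun k => f (τ (k + 1))) atTop (𝓝 0) := by
    have hτ₁ := (tendsto_add_atTop_iff_nat 1).2 hτ_lim
    refine squeeze_zero (fun k => (hpos k).le) (g := fun k => m 0 * (τ (k + 1) - r)) (fun k => ?_) ?_
    · have h := (hm_mono k.zero_le).trans (hmr k)
      rw [le_div_iff₀ (by linarith [hlt (k + 1)]), hfr] at h
      linarith
    · simpa using (hτ₁.sub_const r).const_mul (m 0)
  suffices hsub : g ≤ S by rwa [le_antisymm hSg hsub] at hS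
  refine hg.2 fun y hy => ?_
  rcases lt_or_ge y r with hyr | hyr
  · have hτ₁ := (tendsto_add_atTop_iff_nat 1).2 hτ_lim
    have hev : ∀ᶠ k in atTop, f (τ (k + 1)) - f y ≤ S * (τ (k + 1) - y) := by
      filter_upwards [hτ₁.eventually_const_lt hyr] with k hk
      have h := (hconv.slope_mono_adjacent hy (hmem _) hk (hτ (k + 1).lt_succ_self)).trans
        (hmS (k + 1))
      rwa [div_le_iff₀ (by linarith)] at h
    have h := le_of_tendsto_of_tendsto (hfτ.sub_const (f y)) ((hτ₁.sub_const y).const_mul S) hev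
    rw [hfr]
    linarith
  · have h := hg.1 y hy
    have := mul_le_mul_of_nonneg_right hSg (sub_nonneg.2 hyr)
    linarith

/-- **Superlinear convergence of the secant method (Theorem A.1, secant part).**
Let `f` be a nonincreasing convex function on `[a,b]`, let
`τstar = inf {τ ∈ [a,b] : f τ ≤ 0}` lie in `(a,b)`, and suppose the
nondegeneracy condition `gstar = inf ∂f(τstar) < 0` holds, where the
subdifferential is taken relative to `[a,b]`. Starting from points
`τ 0 < τ 1 < τstar` in `(a,b)`, the secant iteration either terminates
finitely exactly at `τstar`, or else the iterates strictly increase while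
remaining below `τstar`, satisfy
`|τstar − τ (k+1)| ≤ (1 − gstar/γ)·|τstar − τ k|` for every subgradient
`γ ∈ ∂f(τ (k-1))`, and `τ k ↑ τstar` globally q-superlinearly. -/
theorem secant_superlinear
    (f : ℝ → ℝ) (a b : ℝ) (hab : a < b)
    (hconv : ConvexOn ℝ (Set.Icc a b) f)
    (hdec : AntitoneOn f (Set.Icc a b))
    (subdiff : ℝ → Set ℝ)
    (hsubdiff : ∀ t : ℝ,
      subdiff t = {g : ℝ | ∀ t' ∈ Set.Icc a b, f t + g * (t' - t) ≤ f t'})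
    (τstar : ℝ) (hτstar_mem : τstar ∈ Set.Ioo a b)
    (hτstar_inf : IsGLB {t | t ∈ Set.Icc a b ∧ f t ≤ 0} τstar)
    (gstar : ℝ) (hgstar_inf : IsGLB (subdiff τstar) gstar) (hgstar_neg : gstar < 0)
    (τ : ℕ → ℝ)
    (hτ0_mem : τ 0 ∈ Set.Ioo a b) (hτ1_mem : τ 1 ∈ Set.Ioo a b)
    (hτ01 : τ 0 < τ 1) (hτ1_lt : τ 1 < τstar)
    (hiter : ∀ k : ℕ, 1 ≤ k →
      (f (τ k) = 0 → τ (k + 1) = τ k) ∧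
      (f (τ k) ≠ 0 → τ (k + 1) =
        τ k - f (τ k) * (τ k - τ (k - 1)) / (f (τ k) - f (τ (k - 1))))) :
    (∀ k : ℕ, 1 ≤ k → f (τ k) = 0 → τ k = τstar) ∧
    ((∀ k : ℕ, 1 ≤ k → f (τ k) ≠ 0) →
      (∀ k : ℕ, τ k < τ (k + 1)) ∧
      (∀ k : ℕ, τ k < τstar) ∧
      (∀ k : ℕ, 1 ≤ k → ∀ γ ∈ subdiff (τ (k - 1)),
        |τstar - τ (k + 1)| ≤ (1 - gstar / γ) * |τstar - τ k|) ∧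
      Filter.Tendsto τ Filter.atTop (nhds τstar) ∧
      Filter.Tendsto (fun k : ℕ => |τstar - τ (k + 1)| / |τstar - τ k|)
        Filter.atTop (nhds 0)) := by
  have hr : τstar ∈ Icc a b := Ioo_subset_Icc_self hτstar_mem
  have hfr := hconv.eq_zero_of_isGLB_sublevel hdec hτstar_mem hτstar_inf
  have hfpos {t : ℝ} (ht : t ∈ Icc a b) (htr : t < τstar) : 0 < f t := by
    by_contra! h
    exact absurd (hτstar_inf.1 ⟨ht, h⟩) (not_le.2 htr)
  have hleast : IsLeast (subdiff τstar) gstar := by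
    refine ⟨hgstar_inf.mem_of_isClosed hgstar_inf.nonempty ?_, hgstar_inf.1⟩
    rw [hsubdiff]
    exact isClosed_setOf_subgradient f _ _
  rw [hsubdiff] at hleast
  have hstep (k : ℕ) (hk : f (τ (k + 1)) ≠ 0) : τ (k + 2) =
      τ (k + 1) - f (τ (k + 1)) / ((f (τ (k + 1)) - f (τ k)) / (τ (k + 1) - τ k)) := by
    rw [div_div_eq_mul_div]
    exact (hiter (k + 1) (by omega)).2 hk
  have hinv (k : ℕ) : τ (k + 1) = τstar ∨
      (a < τ k ∧ τ k < τ (k + 1) ∧ τ (k + 1) < τstar) := by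
    induction k with
    | zero => exact Or.inr ⟨hτ0_mem.1, hτ01, hτ1_lt⟩
    | succ k ih =>
      rcases ih with h | ⟨h₁, h₂, h₃⟩
      · left
        rw [← h]
        exact (hiter (k + 1) (by omega)).1 (h ▸ hfr)
      · have hx : τ k ∈ Icc a b := ⟨h₁.le, by linarith [hr.2]⟩
        have hpos := hfpos ⟨by linarith, by linarith [hr.2]⟩ h₃
        have hle := hconv.secant_step_le hx hr h₂ h₃ hpos hfr
        have hneg := div_neg_of_pos_of_neg hpos (hconv.secant_slope_neg hx hr h₂ h₃ hpos hfr)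
        rw [← hstep k hpos.ne'] at hle
        refine hle.eq_or_lt.imp id fun hlt => ⟨by linarith, ?_, hlt⟩
        linarith [hstep k hpos.ne']
  refine ⟨fun k hk h0 => ?_, fun hne => ?_⟩
  · obtain ⟨k, rfl⟩ := Nat.exists_eq_add_of_le' hk
    rcases hinv k with h | ⟨h₁, h₂, h₃⟩
    · exact h
    · exact absurd h0 (hfpos ⟨by linarith, by linarith [hr.2]⟩ h₃).ne'
  have hinv' (k : ℕ) : a < τ k ∧ τ k < τ (k + 1) ∧ τ (k + 1) < τstar :=
    (hinv k).resolve_left fun h => hne (k + 1) (by omega) (h ▸ hfr)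
  have hlt (k : ℕ) : τ k < τstar := (hinv' k).2.1.trans (hinv' k).2.2
  have hmem (k : ℕ) : τ k ∈ Icc a b := ⟨(hinv' k).1.le, by linarith [hlt k, hr.2]⟩
  have hpos (k : ℕ) : 0 < f (τ k) := hfpos (hmem k) (hlt k)
  have hm_neg (k : ℕ) : (f (τ (k + 1)) - f (τ k)) / (τ (k + 1) - τ k) < 0 :=
    hconv.secant_slope_neg (hmem k) hr (hinv' k).2.1 (hlt _) (hpos _) hfr
  have herr (k : ℕ) (γ : ℝ) (hγ : γ ≤ (f (τ (k + 1)) - f (τ k)) / (τ (k + 1) - τ k)) :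
      |τstar - τ (k + 2)| ≤ (1 - gstar / γ) * |τstar - τ (k + 1)| := by
    rw [abs_of_pos (sub_pos.2 (hlt _)), abs_of_pos (sub_pos.2 (hlt _)), hstep k (hpos _).ne']
    refine newton_step_error_le hgstar_neg.le hγ (hm_neg k) (hlt _).le ?_
    simpa [hfr] using hleast.1 _ (hmem (k + 1))
  obtain ⟨hτ_lim, hm_lim⟩ := hconv.tendsto_secant hr hfr hleast hgstar_neg hmem
    (strictMono_nat_of_lt_succ fun k => (hinv' k).2.1) hlt (fun k => hpos _)
    fun k => hstep k (hpos _).ne'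
  refine ⟨fun k => (hinv' k).2.1, hlt, fun k hk γ hγ => ?_, hτ_lim, ?_⟩
  · obtain ⟨k, rfl⟩ := Nat.exists_eq_add_of_le' hk
    refine herr k γ ?_
    rw [hsubdiff] at hγ
    rw [le_div_iff₀ (sub_pos.2 (hinv' k).2.1)]
    have := hγ _ (hmem (k + 1))
    simp only [Nat.add_sub_cancel] at this
    linarith
  · rw [← tendsto_add_atTop_iff_nat 1]
    have hlim := ((tendsto_const_nhds (x := gstar)).div hm_lim hgstar_neg.ne).const_sub 1
    rw [div_self hgstar_neg.ne, sub_self] at hlim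
    refine squeeze_zero (fun k => by positivity) (fun k => ?_) hlim
    rw [div_le_iff₀ (abs_pos.2 (sub_pos.2 (hlt _)).ne')]
    exact herr k _ le_rfl
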